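/- Let H be a finite connected simple graph and n ≥ 0. Then H admits an embedding into the hypercube graph Q_n (an injective map of vertices sending adjacent vertices to adjacent vertices) if and only if there exists a labelling ℓ of the edges of H with labels in Fin n such that: in every path in H, some label appears an odd number of times among the edges of the path; and in every cycle in H, every label appears an even number of times among the edges of the cycle. -/

import Mathlib

open SimpleGraph in
theorem cube_aux_back {V : Type} [DecidableEq V] {H : SimpleGraph V} {u v : V}
    (p : H.Walk v u) (hp : p.IsPath) (h : s(u, v) ∈ p.edges) : p.edges = [s(u, v)] := by
  cases p with
  | nil => simp at h
  | cons h' q =>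
    rename_i w
    rw [Walk.cons_isPath_iff] at hp
    rw [Walk.edges_cons, List.mem_cons] at h
    rcases h with h | h
    · have hw : w = u := by
        rw [Sym2.eq_iff] at h
        rcases h with ⟨h1, h2⟩ | ⟨h1, h2⟩
        · exact h2.symm.trans h1.symm
        · exact h1.symm
      subst hw
      have := Walk.isPath_iff_eq_nil.1 hp.1
      subst this
      simp [Sym2.eq_swap]
    · exact absurd (Walk.snd_mem_support_of_mem_edges q h) hp.2

open SimpleGraph in
theorem cube_aux_bypass {V : Type} [DecidableEq V] {H : SimpleGraph V} (P : Sym2 V → Bool)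
    (hc : ∀ u : V, ∀ p : H.Walk u u, p.IsCycle → Even (p.edges.countP P))
    {u v : V} (p : H.Walk u v) :
    Even (p.edges.countP P) ↔ Even (p.bypass.edges.countP P) := by
  induction p with
  | nil => simp [Walk.bypass]
  | @cons u v w h p ih =>
    simp only [Walk.bypass]
    split_ifs with hs
    · have hpath := p.bypass_isPath
      have e1 : p.bypass.edges = (p.bypass.takeUntil u hs).edges ++ (p.bypass.dropUntil u hs).edges := by
        rw [← Walk.edges_append, Walk.take_spec]
      have key : Even ((Walk.cons h (p.bypass.takeUntil u hs)).edges.countP P) := by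
        have htp := hpath.takeUntil hs
        by_cases hm : s(u, v) ∈ (p.bypass.takeUntil u hs).edges
        · rw [Walk.edges_cons, cube_aux_back _ htp hm]
          by_cases hP : P s(u, v) = true <;> simp [List.countP_cons, hP]
        · exact hc _ _ ((Walk.cons_isCycle_iff _ _).2 ⟨htp, hm⟩)
      rw [e1, List.countP_append, Nat.even_add] at ih
      rw [Walk.edges_cons, List.countP_cons, Nat.even_add] at key ⊢
      tauto
    · rw [Walk.edges_cons, Walk.edges_cons, List.countP_cons, List.countP_cons, Nat.even_add,
        Nat.even_add, ih]

open SimpleGraph in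
theorem cube_aux_closed {V : Type} [DecidableEq V] {H : SimpleGraph V} (P : Sym2 V → Bool)
    (hc : ∀ u : V, ∀ p : H.Walk u u, p.IsCycle → Even (p.edges.countP P))
    {u : V} (p : H.Walk u u) : Even (p.edges.countP P) := by
  rw [cube_aux_bypass P hc, Walk.isPath_iff_eq_nil.1 p.bypass_isPath]
  simp

open SimpleGraph in
theorem cube_aux_walk {V : Type} {H : SimpleGraph V} (P : Sym2 V → Bool) (g : V → Bool)
    (hg : ∀ u v, H.Adj u v → (P s(u, v) = true ↔ g u ≠ g v)) {u v : V} (p : H.Walk u v) :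
    Odd (p.edges.countP P) ↔ g u ≠ g v := by
  induction p with
  | nil => simp
  | @cons u v w h p ih =>
    have h1 := hg u v h
    rw [Walk.edges_cons, List.countP_cons, Nat.odd_add, ih]
    by_cases hP : P s(u, v) = true
    · have h2 := h1.1 hP
      simp only [hP, if_true]
      revert h2
      cases g u <;> cases g v <;> cases g w <;> simp
    · have h2 : g u = g v := by
        by_contra h3
        exact hP (h1.2 h3)
      simp [hP, h2]


/-- Havel–Morávek: a finite connected simple graph `H` embeds into the
hypercube graph `Q_n` iff its edges can be labelled with labels in `{0, …, n-1}` so that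
on every (nontrivial) path some label appears an odd number of times, and on every
cycle every label appears an even number of times. -/
theorem graph_embeds_into_cube_iff_labelling
    {V : Type} [Fintype V] [DecidableEq V] (n : ℕ)
    (H : SimpleGraph V) (hconn : H.Connected) :
    (∃ f : V → (Fin n → Bool), Function.Injective f ∧
        ∀ u v : V, H.Adj u v →
          (Finset.univ.filter (fun i => f u i ≠ f v i)).card = 1) ↔
    (∃ ℓ : Sym2 V → ℕ, (∀ e ∈ H.edgeSet, ℓ e < n) ∧
      (∀ u v : V, u ≠ v → ∀ p : H.Walk u v, p.IsPath →
          ∃ i < n, Odd (p.edges.countP (fun e => ℓ e == i))) ∧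
      (∀ u : V, ∀ p : H.Walk u u, p.IsCycle →
          ∀ i : ℕ, Even (p.edges.countP (fun e => ℓ e == i)))) := by
  classical
  constructor
  · rintro ⟨f, hinj, hadj⟩
    have hex : ∀ e : Sym2 V, ∃ k : ℕ, e ∈ H.edgeSet →
        k < n ∧ ∀ u v, e = s(u, v) → ∀ i : Fin n, (k = i ↔ f u i ≠ f v i) := by
      intro e
      induction e using Sym2.ind with
      | _ a b =>
        by_cases hab : H.Adj a b
        · obtain ⟨k, hk⟩ := Finset.card_eq_one.1 (hadj a b hab)
          refine ⟨k, fun _ => ⟨k.2, ?_⟩⟩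
          have hk' : ∀ i, f a i ≠ f b i ↔ i = k := by
            intro i
            have := Finset.ext_iff.1 hk i
            simpa using this
          intro u v huv i
          rw [Sym2.eq_iff] at huv
          rcases huv with ⟨rfl, rfl⟩ | ⟨rfl, rfl⟩
          · rw [hk', Fin.ext_iff, eq_comm]
          · rw [ne_comm, hk', Fin.ext_iff, eq_comm]
        · exact ⟨0, fun h => absurd h hab⟩
    choose ℓ hℓ using hex
    have main : ∀ (i : Fin n) (u v : V) (p : H.Walk u v),
        Odd (p.edges.countP (fun e => ℓ e == (i : ℕ))) ↔ f u i ≠ f v i := by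
      intro i u v p
      refine cube_aux_walk (fun e => ℓ e == (i : ℕ)) (fun v => f v i) ?_ p
      intro u v huv
      simpa using (hℓ s(u, v) huv).2 u v rfl i
    refine ⟨ℓ, fun e he => (hℓ e he).1, ?_, ?_⟩
    · intro u v huv p _
      have : f u ≠ f v := fun h => huv (hinj h)
      obtain ⟨i, hi⟩ := Function.ne_iff.1 this
      exact ⟨i, i.2, (main i u v p).2 hi⟩
    · intro u p _ i
      by_cases hi : i < n
      · rw [← Nat.not_odd_iff_even]
        intro h
        exact (main ⟨i, hi⟩ u u p).1 h rfl
      · have : p.edges.countP (fun e => ℓ e == i) = 0 := by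
          rw [List.countP_eq_zero]
          intro e he
          have := (hℓ e (p.edges_subset_edgeSet he)).1
          simp only [beq_iff_eq]
          omega
        rw [this]
        exact Even.zero
  · rintro ⟨ℓ, hlt, hpath, hcyc⟩
    obtain ⟨r⟩ := hconn.nonempty
    have hw : ∀ v, ∃ _w : H.Walk r v, True := fun v => ⟨(hconn.preconnected r v).some, trivial⟩
    choose W _ using hw
    let f : V → Fin n → Bool := fun v i => decide (Odd ((W v).edges.countP (fun e => ℓ e == (i : ℕ))))
    have main : ∀ (i : Fin n) (u v : V) (p : H.Walk u v),
        Odd (p.edges.countP (fun e => ℓ e == (i : ℕ))) ↔ f u i ≠ f v i := by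
      intro i u v p
      have h := cube_aux_closed (fun e => ℓ e == (i : ℕ)) (fun u p hp => hcyc u p hp i)
        ((W u).append (p.append (W v).reverse))
      rw [SimpleGraph.Walk.edges_append, SimpleGraph.Walk.edges_append,
        SimpleGraph.Walk.edges_reverse, List.countP_append, List.countP_append,
        List.countP_reverse, Nat.even_add, Nat.even_add] at h
      simp only [f, ne_eq, decide_eq_decide, ← Nat.not_even_iff_odd]
      tauto
    refine ⟨f, ?_, ?_⟩
    · intro u v huv
      by_contra hne
      obtain ⟨p, hp⟩ := (hconn.preconnected u v).exists_isPath
      obtain ⟨i, hi, ho⟩ := hpath u v hne p hp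
      exact (main ⟨i, hi⟩ u v p).1 ho (by rw [huv])
    · intro u v huv
      rw [Finset.card_eq_one]
      refine ⟨⟨ℓ s(u, v), hlt _ huv⟩, ?_⟩
      ext i
      rw [Finset.mem_filter, ← main i u v (SimpleGraph.Walk.cons huv SimpleGraph.Walk.nil),
        Finset.mem_singleton, Fin.ext_iff]
      by_cases h : ℓ s(u, v) = (i : ℕ)
      · simp [h]
      · simp [h, Ne.symm h]
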